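/- Let f ∈ WRP with sign ε and dual g (in particular W_f(0) = ε √(p*)^{n+s}). For β ∈ F_q^* define N_{f,β} = #{x ∈ F_q : f(x) = 0 and Tr(βx) = 0}. Then: (i) for every β ∈ F_q^* \ Supp(W_f), N_{f,β} = p^{n−2} + ε(p−1)√(p*)^{n+s−4} if n+s is even, and N_{f,β} = p^{n−2} if n+s is odd; (ii) for every nonzero β ∈ Supp(W_f), if n+s is even then N_{f,β} = p^{n−2} + ε η_0(−1)(p−1)√(p*)^{n+s−2} when g(β) = 0 and N_{f,β} = p^{n−2} when g(β) ≠ 0; if n+s is odd then N_{f,β} = p^{n−2} when g(β) = 0, N_{f,β} = p^{n−2} + ε(p−1)√(p*)^{n+s−3} when g(β) ∈ SQ, and N_{f,β} = p^{n−2} − ε(p−1)√(p*)^{n+s−3} when g(β) ∈ NSQ. -/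

import Mathlib

open scoped BigOperators Classical

noncomputable section

/-- `ξ_p^j` for `j : ZMod p`, where `ξ_p = exp(2πi/p)` and the exponent `j`
is lifted to a natural number. -/
def ep (p : ℕ) (j : ZMod p) : ℂ :=
  Complex.exp (2 * Real.pi * Complex.I * (j.val : ℂ) / (p : ℂ))

/-- `√(p*)`: equal to `√p` if `p ≡ 1 (mod 4)` and to `i√p` if `p ≡ 3 (mod 4)`. -/
def sqrtPStar (p : ℕ) : ℂ :=
  if p % 4 = 1 then ((Real.sqrt p : ℝ) : ℂ) else Complex.I * ((Real.sqrt p : ℝ) : ℂ)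

/-- The quadratic character `η₀` of `F_p` (extended by `η₀(0) = 0`), with values in `ℂ`. -/
def eta0 (p : ℕ) [Fact p.Prime] (j : ZMod p) : ℂ :=
  ((quadraticChar (ZMod p) j : ℤ) : ℂ)

/-- The Walsh transform of `f : F_q → F_p`. -/
def walsh (p : ℕ) {F : Type*} [Field F] [Fintype F] [Algebra (ZMod p) F]
    (f : F → ZMod p) (β : F) : ℂ :=
  ∑ x : F, ep p (f x - Algebra.trace (ZMod p) F (β * x))

/-- `f` is weakly regular `s`-plateaued with sign `ε` and dual `g`:
`W_f(β) = ε √(p*)^{n+s} ξ_p^{g(β)}` on the Walsh support, `W_f(β) = 0` off it,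
and `g` vanishes off the Walsh support. -/
def IsWeaklyRegularPlateaued (p n s : ℕ) {F : Type*} [Field F] [Fintype F]
    [Algebra (ZMod p) F] (f : F → ZMod p) (ε : ℂ) (g : F → ZMod p) : Prop :=
  (ε = 1 ∨ ε = -1) ∧
  (∀ β : F, walsh p f β ≠ 0 →
      walsh p f β = ε * sqrtPStar p ^ (n + s) * ep p (g β)) ∧
  (∀ β : F, walsh p f β = 0 → g β = 0)

/-- `f` lies in the class `WRP`: weakly regular `s`-plateaued with sign `ε` and dual `g`,
unbalanced, `f(0) = 0`, and `f(ax) = a^h f(x)` for some positive even `h` with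
`gcd(h-1, p-1) = 1`. -/
def IsWRP (p n s : ℕ) {F : Type*} [Field F] [Fintype F]
    [Algebra (ZMod p) F] (f : F → ZMod p) (ε : ℂ) (g : F → ZMod p) : Prop :=
  IsWeaklyRegularPlateaued p n s f ε g ∧
  walsh p f 0 ≠ 0 ∧
  f 0 = 0 ∧
  ∃ h : ℕ, 0 < h ∧ Even h ∧ Nat.gcd (h - 1) (p - 1) = 1 ∧
    ∀ (a : (ZMod p)ˣ) (x : F),
      f (algebraMap (ZMod p) F (a : ZMod p) * x) = (a : ZMod p) ^ h * f x

open Polynomial in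
/-- The image in `ℤ[X]` of the exponential sum `∑ x, ξ_p^{φ x}`. -/
def expPoly (p : ℕ) {ι : Type*} [Fintype ι] (φ : ι → ZMod p) : Polynomial ℤ :=
  ∑ x, X ^ (φ x).val

open Polynomial in
/-- The polynomial `∑ j, η₀(j) X^j` whose value at `ξ_p` is the quadratic Gauss sum. -/
def gaussPoly (p : ℕ) [Fact p.Prime] : Polynomial ℤ :=
  ∑ j : ZMod p, C (quadraticChar (ZMod p) j) * X ^ j.val

open Polynomial in
/-- A polynomial whose value at `ξ_p` is `√(p*)`. -/
def sinePoly (h : ℕ) : Polynomial ℤ :=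
  ∏ k ∈ Finset.range h, (X ^ (2 * h * (h + 1) * (k + 1)) * (1 - X ^ (k + 1)))

section Basic

variable {p : ℕ} [Fact p.Prime]

lemma ep_eq_stdAddChar (j : ZMod p) : ep p j = ZMod.stdAddChar j := by
  rw [ZMod.stdAddChar_apply, ZMod.toCircle_apply, ep]

lemma ep_zero : ep p 0 = 1 := by simp [ep]

lemma ep_add (i j : ZMod p) : ep p (i + j) = ep p i * ep p j := by
  simp only [ep_eq_stdAddChar, AddChar.map_add_eq_mul]

lemma ep_pow_val (i j : ZMod p) : ep p i ^ j.val = ep p (i * j) := by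
  rw [ep_eq_stdAddChar, ep_eq_stdAddChar, ← AddChar.map_nsmul_eq_pow, nsmul_eq_mul,
    ZMod.natCast_zmod_val, mul_comm]

lemma ep_one : ep p 1 = Complex.exp (2 * Real.pi * Complex.I / p) := by
  have : Fact (1 < p) := ⟨(Fact.out : p.Prime).one_lt⟩
  simp [ep, ZMod.val_one]

lemma isPrimitiveRoot_ep_one : IsPrimitiveRoot (ep p 1) p := by
  rw [ep_one]
  exact Complex.isPrimitiveRoot_exp p (Fact.out : p.Prime).ne_zero

lemma isPrimitiveRoot_ep {y : ZMod p} (hy : y ≠ 0) : IsPrimitiveRoot (ep p y) p := by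
  have h : ep p y = ep p 1 ^ y.val := by rw [ep_pow_val, one_mul]
  rw [h]
  exact isPrimitiveRoot_ep_one.pow_of_coprime _ ((ZMod.val_coe_unit_coprime (Units.mk0 y hy)))

lemma sum_ep_mul (t : ZMod p) : ∑ y : ZMod p, ep p (y * t) = if t = 0 then (p : ℂ) else 0 := by
  simp only [ep_eq_stdAddChar]
  rw [AddChar.sum_mulShift t (ZMod.isPrimitive_stdAddChar p)]
  split_ifs <;> simp [ZMod.card]

lemma sum_ne_zero_eq {M : Type*} [AddCommGroup M] (u : ZMod p → M) :
    ∑ y ∈ Finset.univ.erase 0, u y = ∑ y, u y - u 0 := by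
  rw [← Finset.add_sum_erase _ _ (Finset.mem_univ (0 : ZMod p))]; abel

open Polynomial

lemma cyclotomic_dvd_of_aeval_ep_eq_zero {P : ℤ[X]} (h : aeval (ep p 1) P = 0) :
    cyclotomic p ℤ ∣ P := by
  have hp := (Fact.out : p.Prime).pos
  rw [cyclotomic_eq_minpoly isPrimitiveRoot_ep_one hp]
  exact minpoly.isIntegrallyClosed_dvd (isPrimitiveRoot_ep_one.isIntegral hp) h

lemma aeval_eq_of_aeval_ep_eq {R : Type*} [CommRing R] [IsDomain R] {ω : R}
    (hω : IsPrimitiveRoot ω p) {P Q : ℤ[X]} (h : aeval (ep p 1) P = aeval (ep p 1) Q) :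
    aeval ω P = aeval ω Q := by
  have hd : cyclotomic p ℤ ∣ P - Q :=
    cyclotomic_dvd_of_aeval_ep_eq_zero (by rw [map_sub, h, sub_self])
  obtain ⟨S, hS⟩ := hd
  have hr : aeval ω (cyclotomic p ℤ) = 0 := by
    have := hω.isRoot_cyclotomic (Fact.out : p.Prime).pos
    rwa [← map_cyclotomic p (algebraMap ℤ R), IsRoot, eval_map_algebraMap] at this
  rw [← sub_eq_zero, ← map_sub, hS, map_mul, hr, zero_mul]

lemma aeval_ep_expPoly {ι : Type*} [Fintype ι] (φ : ι → ZMod p) (y : ZMod p) :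
    aeval (ep p y) (expPoly p φ) = ∑ x, ep p (y * φ x) := by
  simp [expPoly, ep_pow_val]

lemma aeval_ep_gaussPoly (y : ZMod p) :
    aeval (ep p y) (gaussPoly p) = ∑ j, eta0 p j * ep p (y * j) := by
  simp [gaussPoly, ep_pow_val, eta0]

lemma eta0_sq {y : ZMod p} (hy : y ≠ 0) : eta0 p y ^ 2 = 1 := by
  rw [eta0]; exact_mod_cast quadraticChar_sq_one hy

lemma eta0_mul (x y : ZMod p) : eta0 p (x * y) = eta0 p x * eta0 p y := by
  rw [eta0, map_mul, Int.cast_mul]; rfl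

lemma sum_eta0_mul_ep (y : ZMod p) (hy : y ≠ 0) :
    ∑ j, eta0 p j * ep p (y * j) = eta0 p y * ∑ j, eta0 p j * ep p j := by
  rw [Finset.mul_sum]
  refine Fintype.sum_equiv (Equiv.mulLeft₀ y hy) _ _ fun j => ?_
  change _ = eta0 p y * (eta0 p (y * j) * ep p (y * j))
  rw [eta0_mul, ← mul_assoc, ← mul_assoc, ← sq, eta0_sq hy, one_mul]

lemma sum_eta0 (hp : p ≠ 2) : ∑ j, eta0 p j = 0 := by
  have := quadraticChar_sum_zero (F := ZMod p) (by rwa [ZMod.ringChar_zmod_n])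
  simp only [eta0]
  exact_mod_cast this

lemma sum_eta0_mul_ep_sq (hp : p ≠ 2) :
    (∑ j, eta0 p j * ep p j) ^ 2 = (-1) ^ (p / 2) * p := by
  have hc : ringChar (ZMod p) ≠ 2 := by rwa [ZMod.ringChar_zmod_n]
  have h := gaussSum_sq (χ := (quadraticChar (ZMod p)).ringHomComp (Int.castRingHom ℂ))
    ?_ ?_ (ZMod.isPrimitive_stdAddChar p)
  · simp only [gaussSum, MulChar.ringHomComp_apply, quadraticChar_neg_one hc, ZMod.card] at h
    rw [ZMod.χ₄_eq_neg_one_pow ((Fact.out : p.Prime).eq_two_or_odd.resolve_left hp)] at h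
    simpa [eta0, ep_eq_stdAddChar] using h
  · intro h1
    obtain ⟨a, ha⟩ := quadraticChar_exists_neg_one' hc
    have := congrArg (fun χ => χ (a : ZMod p)) h1
    simp [ha] at this
    norm_num at this
  · exact (quadraticChar_isQuadratic (ZMod p)).comp _

lemma coeff_taylor_gaussPoly {h : ℕ} (hh : p = 2 * h + 1) (hp : p ≠ 2) :
    (h.factorial : ZMod p) *
      (taylor 1 ((gaussPoly p).map (Int.castRingHom (ZMod p)))).coeff h = -1 := by
  have hc : ringChar (ZMod p) ≠ 2 := by rwa [ZMod.ringChar_zmod_n]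
  have hd : p / 2 = h := by omega
  have h1 : (taylor 1 ((gaussPoly p).map (Int.castRingHom (ZMod p)))).coeff h =
      ∑ j : ZMod p, j ^ h * (j.val.choose h : ZMod p) := by
    simp only [gaussPoly, Polynomial.map_sum, Polynomial.map_mul, map_C, Polynomial.map_pow, map_X,
      map_sum, finsetSum_coeff]
    refine Finset.sum_congr rfl fun j _ => ?_
    rw [C_mul_X_pow_eq_monomial, taylor_coeff, hasseDeriv_monomial, eval_monomial, one_pow, mul_one,
      mul_comm, eq_intCast (Int.castRingHom (ZMod p)), quadraticChar_eq_pow_of_char_ne_two' hc, ZMod.card, hd]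
  have h2 : ∀ j : ZMod p, (h.factorial : ZMod p) * (j ^ h * (j.val.choose h : ZMod p)) =
      ∑ i ∈ Finset.range (h + 1), (descPochhammer (ZMod p) h).coeff i * j ^ (h + i) := by
    intro j
    have h3 := descPochhammer_eval_eq_descFactorial (ZMod p) j.val h
    rw [ZMod.natCast_zmod_val, Nat.descFactorial_eq_factorial_mul_choose, Nat.cast_mul,
      eval_eq_sum_range, descPochhammer_natDegree] at h3
    rw [mul_left_comm, ← h3, Finset.mul_sum]
    exact Finset.sum_congr rfl fun i _ => by ring
  rw [h1, Finset.mul_sum, Finset.sum_congr rfl fun j _ => h2 j, Finset.sum_comm,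
    Finset.sum_range_succ, Finset.sum_eq_zero, zero_add]
  · have h4 : (descPochhammer (ZMod p) h).coeff h = 1 := by
      have := monic_descPochhammer (ZMod p) h
      rwa [Monic, leadingCoeff, descPochhammer_natDegree] at this
    have h5 : h ≠ 0 := by rintro rfl; exact (Fact.out : p.Prime).one_lt.ne' (by omega)
    simp only [h4, one_mul]
    have h6 : ∀ j : ZMod p, j ^ (h + h) = if j = 0 then 0 else 1 := by
      intro j
      split_ifs with hj
      · rw [hj, zero_pow (by omega)]
      · rw [show h + h = p - 1 by omega, ZMod.pow_card_sub_one_eq_one hj]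
    simp only [h6]
    rw [Finset.sum_ite, Finset.sum_const_zero, zero_add, Finset.sum_const, nsmul_eq_mul, mul_one,
      Finset.filter_ne', Finset.card_erase_of_mem (Finset.mem_univ _), Finset.card_univ, ZMod.card,
      Nat.cast_sub (Fact.out : p.Prime).one_le]
    simp
  · intro i hi
    rw [← Finset.mul_sum, FiniteField.sum_pow_lt_card_sub_one, mul_zero]
    rw [ZMod.card]
    have := Finset.mem_range.mp hi
    omega

lemma coeff_taylor_sinePoly {h : ℕ} (hh : p = 2 * h + 1) :
    (h.factorial : ZMod p) *
      (taylor 1 ((sinePoly h).map (Int.castRingHom (ZMod p)))).coeff h = -1 := by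
  have h1 : (sinePoly h).map (Int.castRingHom (ZMod p)) = (X - C 1) ^ h *
      ∏ k ∈ Finset.range h,
        (X ^ (2 * h * (h + 1) * (k + 1)) * (-∑ i ∈ Finset.range (k + 1), X ^ i)) := by
    have h0 : (X - C 1 : (ZMod p)[X]) ^ h = ∏ _k ∈ Finset.range h, (X - C 1) := by simp
    rw [sinePoly, Polynomial.map_prod, h0, ← Finset.prod_mul_distrib]
    refine Finset.prod_congr rfl fun k _ => ?_
    simp only [Polynomial.map_mul, Polynomial.map_sub, Polynomial.map_pow, map_X,
      Polynomial.map_one, C_1]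
    linear_combination (X ^ (2 * h * (h + 1) * (k + 1))) * geom_sum_mul (X : (ZMod p)[X]) (k + 1)
  have h2 : (taylor 1 ((sinePoly h).map (Int.castRingHom (ZMod p)))).coeff h =
      ∏ k ∈ Finset.range h, (-((k : ZMod p) + 1)) := by
    rw [h1, taylor_mul, taylor_pow, map_sub, taylor_X, taylor_C, add_sub_cancel_right,
      coeff_X_pow_mul', if_pos le_rfl, Nat.sub_self, taylor_coeff_zero, eval_prod]
    simp [eval_finsetSum]
  rw [h2, ← ZMod.wilsons_lemma p, show p - 1 = h + h by omega, ← Nat.factorial_mul_ascFactorial,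
    Nat.cast_mul, Nat.ascFactorial_eq_prod_range, Nat.cast_prod]
  congr 1
  rw [← Finset.prod_range_reflect]
  refine Finset.prod_congr rfl fun k hk => ?_
  have := Finset.mem_range.mp hk
  have h3 : ((h + 1 + k : ℕ) : ZMod p) + ((h - 1 - k : ℕ) + 1) = 0 := by
    rw [← Nat.cast_succ, ← Nat.cast_add, show h + 1 + k + (h - 1 - k).succ = p by omega,
      ZMod.natCast_self]
  linear_combination -h3

lemma prod_neg_one_pow_mul_I (h : ℕ) :
    ∏ k ∈ Finset.range h, ((-1) ^ k * Complex.I) = if Even h then 1 else Complex.I := by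
  induction h with
  | zero => simp
  | succ h ih =>
    rw [Finset.prod_range_succ, ih]
    rcases Nat.even_or_odd h with he | ho
    · simp [he, he.neg_one_pow, Nat.even_add_one]
    · simp [Nat.not_even_iff_odd.mpr ho, ho.neg_one_pow, Nat.even_add_one]

lemma exp_neg_sub_exp (t : ℝ) :
    Complex.exp (-(t * Complex.I)) - Complex.exp (t * Complex.I) =
      -(2 * Complex.I * (Real.sin t : ℝ)) := by
  rw [← neg_mul, Complex.exp_mul_I, Complex.exp_mul_I, Complex.cos_neg, Complex.sin_neg,
    Complex.ofReal_sin]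
  ring

lemma ep_one_pow (m : ℕ) :
    ep p 1 ^ m = Complex.exp (((Real.pi * m / p : ℝ) : ℂ) * Complex.I) ^ 2 := by
  rw [ep_one, ← Complex.exp_nat_mul, ← Complex.exp_nat_mul]
  congr 1
  push_cast
  ring

lemma aeval_sinePoly_factor {h : ℕ} (hh : p = 2 * h + 1) (k : ℕ) :
    ep p 1 ^ (2 * h * (h + 1) * (k + 1)) * (1 - ep p 1 ^ (k + 1)) =
      (-1) ^ k * Complex.I * ((2 * Real.sin (Real.pi * (k + 1 : ℕ) / p) : ℝ) : ℂ) := by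
  have hp0 : (p : ℂ) ≠ 0 := by exact_mod_cast (Fact.out : p.Prime).ne_zero
  set t : ℝ := Real.pi * (k + 1 : ℕ) / p with ht
  have h1 : ep p 1 ^ (2 * h * (h + 1) * (k + 1)) =
      (-1) ^ (k + 1) * Complex.exp (-(t * Complex.I)) := by
    have h2 : ((-1 : ℂ)) ^ (k + 1) = Complex.exp (((p * (k + 1) : ℕ) : ℂ) * (Real.pi * Complex.I)) := by
      rw [Complex.exp_nat_mul, Complex.exp_pi_mul_I, pow_mul, Odd.neg_one_pow ⟨h, hh⟩]
    rw [h2, ep_one, ← Complex.exp_nat_mul, ← Complex.exp_add]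
    congr 1
    have hc : (p : ℂ) = 2 * h + 1 := by exact_mod_cast hh
    rw [ht]
    push_cast
    field_simp
    rw [hc]
    ring
  rw [h1, ep_one_pow, ← ht, pow_succ (-1 : ℂ) k]
  have h3 := exp_neg_sub_exp t
  have h4 : Complex.exp (-(t * Complex.I)) * Complex.exp (t * Complex.I) = 1 := by
    rw [← Complex.exp_add, neg_add_cancel, Complex.exp_zero]
  push_cast at h3 ⊢
  linear_combination (-(-1) ^ k) * h3 + (-1) ^ k * Complex.exp (t * Complex.I) * h4

lemma one_sub_mul_one_sub_ep_pow {m : ℕ} (hm : m ≤ p) :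
    (1 - ep p 1 ^ m) * (1 - ep p 1 ^ (p - m)) =
      (((2 * Real.sin (Real.pi * m / p)) ^ 2 : ℝ) : ℂ) := by
  have h1 : ep p 1 ^ m * ep p 1 ^ (p - m) = 1 := by
    rw [← pow_add, Nat.add_sub_cancel' hm, isPrimitiveRoot_ep_one.pow_eq_one]
  rw [ep_one_pow m] at h1 ⊢
  set t : ℝ := Real.pi * m / p with ht
  have h3 := exp_neg_sub_exp t
  have h4 : Complex.exp (-(t * Complex.I)) * Complex.exp (t * Complex.I) = 1 := by
    rw [← Complex.exp_add, neg_add_cancel, Complex.exp_zero]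
  have h5 : ep p 1 ^ (p - m) = Complex.exp (-(t * Complex.I)) ^ 2 := by
    have h6 : Complex.exp (t * Complex.I) ^ 2 ≠ 0 := pow_ne_zero _ (Complex.exp_ne_zero _)
    apply mul_left_cancel₀ h6
    rw [h1, ← mul_pow, mul_comm, h4, one_pow]
  rw [h5]
  push_cast at h3 ⊢
  have h7 := congrArg (· ^ 2) h3
  simp only [neg_sq, mul_pow, Complex.I_sq] at h7
  linear_combination -h7 +
    (Complex.exp (-(t * Complex.I)) * Complex.exp (t * Complex.I) - 1) * h4

lemma prod_two_sin_sq {h : ℕ} (hh : p = 2 * h + 1) :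
    (∏ k ∈ Finset.range h, (2 * Real.sin (Real.pi * (k + 1 : ℕ) / p))) ^ 2 = p := by
  have hprim : IsPrimitiveRoot (ep p 1) (h + h + 1) := by
    have := isPrimitiveRoot_ep_one (p := p)
    rwa [show h + h + 1 = p by omega]
  have h1 := hprim.prod_one_sub_pow_eq_order
  rw [Finset.prod_range_add, ← Finset.prod_range_reflect (fun x => 1 - ep p 1 ^ (h + x + 1)),
    ← Finset.prod_mul_distrib] at h1
  have h2 : ∀ k ∈ Finset.range h,
      (1 - ep p 1 ^ (k + 1)) * (1 - ep p 1 ^ (h + (h - 1 - k) + 1)) =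
        (((2 * Real.sin (Real.pi * (k + 1 : ℕ) / p)) ^ 2 : ℝ) : ℂ) := by
    intro k hk
    have := Finset.mem_range.mp hk
    rw [← one_sub_mul_one_sub_ep_pow (by omega), show h + (h - 1 - k) + 1 = p - (k + 1) by omega]
  rw [Finset.prod_congr rfl h2, ← Complex.ofReal_prod, Finset.prod_pow] at h1
  have h3 : ((h + h : ℕ) : ℂ) + 1 = ((p : ℝ) : ℂ) := by
    rw [hh]; push_cast; ring
  rw [h3] at h1
  exact_mod_cast h1

lemma aeval_ep_sinePoly {h : ℕ} (hh : p = 2 * h + 1) :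
    aeval (ep p 1) (sinePoly h) = sqrtPStar p := by
  have h1 : aeval (ep p 1) (sinePoly h) = ∏ k ∈ Finset.range h,
      ((-1) ^ k * Complex.I * ((2 * Real.sin (Real.pi * (k + 1 : ℕ) / p) : ℝ) : ℂ)) := by
    simp only [sinePoly, map_prod, map_mul, map_sub, map_pow, aeval_X, map_one]
    exact Finset.prod_congr rfl fun k _ => aeval_sinePoly_factor hh k
  have hp0 : (0 : ℝ) < p := by exact_mod_cast (Fact.out : p.Prime).pos
  have hpos : 0 ≤ ∏ k ∈ Finset.range h, (2 * Real.sin (Real.pi * (k + 1 : ℕ) / p)) := by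
    refine Finset.prod_nonneg fun k hk => mul_nonneg zero_le_two ?_
    have hk' : ((k + 1 : ℕ) : ℝ) ≤ p := by
      have := Finset.mem_range.mp hk
      exact_mod_cast (by omega : k + 1 ≤ p)
    refine Real.sin_nonneg_of_nonneg_of_le_pi (by positivity) ?_
    rw [div_le_iff₀ hp0]
    exact mul_le_mul_of_nonneg_left hk' Real.pi_pos.le
  rw [h1, Finset.prod_mul_distrib, prod_neg_one_pow_mul_I, ← Complex.ofReal_prod,
    ← Real.sqrt_sq hpos, prod_two_sin_sq hh, sqrtPStar]
  rcases Nat.even_or_odd' h with ⟨t, rfl | rfl⟩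
  · rw [if_pos (even_two_mul t), if_pos (by omega), one_mul]
  · rw [if_neg (by simp), if_neg (by omega)]

lemma sqrtPStar_sq (hp : p ≠ 2) : sqrtPStar p ^ 2 = (-1) ^ (p / 2) * p := by
  have h1 : ((Real.sqrt p : ℝ) : ℂ) ^ 2 = p := by
    rw [← Complex.ofReal_pow, Real.sq_sqrt (Nat.cast_nonneg p), Complex.ofReal_natCast]
  have hodd := (Fact.out : p.Prime).eq_two_or_odd.resolve_left hp
  rw [sqrtPStar]
  split_ifs with h4
  · rw [h1, Even.neg_one_pow (Nat.even_iff.mpr (by omega)), one_mul]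
  · rw [mul_pow, h1, Complex.I_sq, Odd.neg_one_pow (Nat.odd_iff.mpr (by omega))]

lemma sqrtPStar_ne_zero : sqrtPStar p ≠ 0 := by
  have hp0 : (0 : ℝ) < p := by exact_mod_cast (Fact.out : p.Prime).pos
  have : ((Real.sqrt p : ℝ) : ℂ) ≠ 0 := by exact_mod_cast (Real.sqrt_pos.mpr hp0).ne'
  rw [sqrtPStar]
  split_ifs
  · exact this
  · exact mul_ne_zero Complex.I_ne_zero this

lemma eta0_neg_one (hp : p ≠ 2) : eta0 p (-1) = (-1) ^ (p / 2) := by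
  have hc : ringChar (ZMod p) ≠ 2 := by rwa [ZMod.ringChar_zmod_n]
  rw [eta0, quadraticChar_neg_one hc, ZMod.card,
    ZMod.χ₄_eq_neg_one_pow ((Fact.out : p.Prime).eq_two_or_odd.resolve_left hp)]
  push_cast
  rfl

/-- Gauss's determination of the sign of the quadratic Gauss sum. -/
theorem sum_eta0_mul_ep_eq_sqrtPStar (hp : p ≠ 2) :
    ∑ j, eta0 p j * ep p j = sqrtPStar p := by
  obtain ⟨h, hh⟩ : ∃ h, p = 2 * h + 1 :=
    ⟨p / 2, by have := (Fact.out : p.Prime).eq_two_or_odd.resolve_left hp; omega⟩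
  have hG := aeval_ep_gaussPoly (p := p) 1
  simp only [one_mul] at hG
  rcases sq_eq_sq_iff_eq_or_eq_neg.mp
    ((sum_eta0_mul_ep_sq hp).trans (sqrtPStar_sq hp).symm) with h1 | h1
  · exact h1
  exfalso
  have hd : cyclotomic p ℤ ∣ gaussPoly p + sinePoly h := by
    apply cyclotomic_dvd_of_aeval_ep_eq_zero
    rw [map_add, hG, h1, aeval_ep_sinePoly hh, neg_add_cancel]
  have hd' := Polynomial.map_dvd (Int.castRingHom (ZMod p)) hd
  have hcyc : cyclotomic p (ZMod p) = (X - C 1) ^ (p - 1) := by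
    have := cyclotomic_mul_prime_eq_pow_of_not_dvd (ZMod p) (p := p) (n := 1)
      (Fact.out : p.Prime).not_dvd_one
    rwa [one_mul, cyclotomic_one] at this
  rw [map_cyclotomic, hcyc, Polynomial.map_add] at hd'
  obtain ⟨S, hS⟩ := hd'
  have hcoeff := congrArg (fun P => (h.factorial : ZMod p) * (taylor 1 P).coeff h) hS
  have hlt : ¬ (p - 1 ≤ h) := by have := (Fact.out : p.Prime).one_lt; omega
  simp only [map_add, coeff_add, mul_add, coeff_taylor_gaussPoly hh hp, coeff_taylor_sinePoly hh,
    taylor_mul, taylor_pow, map_sub, taylor_X, taylor_C, add_sub_cancel_right,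
    coeff_X_pow_mul', if_neg hlt, mul_zero] at hcoeff
  have h2 : (2 : ZMod p) = 0 := by linear_combination -hcoeff
  have h3 : p ∣ 2 := (ZMod.natCast_eq_zero_iff 2 p).mp (by exact_mod_cast h2)
  exact hp ((Nat.prime_dvd_prime_iff_eq Fact.out Nat.prime_two).mp h3)

lemma sum_ep_twist_of_eq_zero {ι : Type*} [Fintype ι] {φ : ι → ZMod p} (hφ : ∑ x, ep p (φ x) = 0)
    {y : ZMod p} (hy : y ≠ 0) : ∑ x, ep p (y * φ x) = 0 := by
  have h := aeval_eq_of_aeval_ep_eq (isPrimitiveRoot_ep hy) (P := expPoly p φ) (Q := 0)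
    (by rw [aeval_ep_expPoly, map_zero]; simpa using hφ)
  rwa [aeval_ep_expPoly, map_zero] at h

lemma aeval_expPoly_eq (hp : p ≠ 2) {ι : Type*} [Fintype ι] {φ : ι → ZMod p} {e : ℤ} {m : ℕ}
    {c : ZMod p} (hφ : ∑ x, ep p (φ x) = e * sqrtPStar p ^ m * ep p c)
    {R : Type*} [CommRing R] [IsDomain R] {ω : R} (hω : IsPrimitiveRoot ω p) :
    aeval ω (expPoly p φ) = e * aeval ω (gaussPoly p) ^ m * ω ^ c.val := by
  have h := aeval_eq_of_aeval_ep_eq hω (P := expPoly p φ)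
    (Q := C e * gaussPoly p ^ m * X ^ c.val) ?_
  · simpa using h
  · rw [aeval_ep_expPoly]
    simp only [one_mul, hφ, map_mul, map_pow, aeval_ep_gaussPoly, aeval_X, ep_pow_val,
      sum_eta0_mul_ep_eq_sqrtPStar hp, aeval_C]
    simp

lemma sum_ep_twist_of_eq (hp : p ≠ 2) {ι : Type*} [Fintype ι] {φ : ι → ZMod p} {e : ℤ} {m : ℕ}
    {c : ZMod p} (hφ : ∑ x, ep p (φ x) = e * sqrtPStar p ^ m * ep p c)
    {y : ZMod p} (hy : y ≠ 0) :
    ∑ x, ep p (y * φ x) = e * (eta0 p y * sqrtPStar p) ^ m * ep p (y * c) := by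
  have h := aeval_expPoly_eq hp hφ (isPrimitiveRoot_ep hy)
  rwa [aeval_ep_expPoly, aeval_ep_gaussPoly, sum_eta0_mul_ep y hy,
    sum_eta0_mul_ep_eq_sqrtPStar hp, ep_pow_val] at h

/-- An odd number of terms is congruent to `1` modulo `2`, which is incompatible with a nontrivial
root of unity as a factor of the exponential sum. -/
lemma eq_zero_of_sum_ep_eq (hp : p ≠ 2) {F : Type*} [Field F] [Fintype F] [Algebra (ZMod p) F]
    {f : F → ZMod p} {K : Type*} [Field K] [CharP K 2] {ω : K} (hω : IsPrimitiveRoot ω p)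
    (hf0 : f 0 = 0) (hneg : ∀ x, f (-x) = f x) {e : ℤ} (he : e ^ 2 = 1) {m : ℕ}
    {c : ZMod p} (hf : ∑ x, ep p (f x) = e * sqrtPStar p ^ m * ep p c) :
    c = 0 := by
  have hpp : p.Prime := Fact.out
  have hodd := hpp.odd_of_ne_two hp
  have hpK : (p : K) = 1 := by
    obtain ⟨k, hk⟩ := hodd
    rw [hk, Nat.cast_add_one, Nat.cast_mul, Nat.cast_ofNat, CharTwo.two_eq_zero, zero_mul, zero_add]
  have h1 := aeval_expPoly_eq hp hf hω
  have h2 : aeval ω (expPoly p f) = 1 := by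
    have h2F : (2 : F) ≠ 0 := by
      intro h
      have h' : algebraMap (ZMod p) F ((2 : ℕ) : ZMod p) = 0 := by
        rw [map_natCast, Nat.cast_ofNat, h]
      rw [map_eq_zero, ZMod.natCast_eq_zero_iff] at h'
      exact hp ((Nat.prime_dvd_prime_iff_eq hpp Nat.prime_two).mp h')
    simp only [expPoly, map_sum, map_pow, aeval_X]
    rw [← Finset.add_sum_erase _ _ (Finset.mem_univ (0 : F)), hf0, ZMod.val_zero, pow_zero,
      Finset.sum_involution (fun x _ => -x), add_zero]
    · intro x _
      rw [hneg, CharTwo.add_self_eq_zero]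
    · intro x hx _ hxx
      have : (2 : F) * x = 0 := by linear_combination -hxx
      exact (Finset.ne_of_mem_erase hx) ((mul_eq_zero.mp this).resolve_left h2F)
    · intro x hx
      simpa using hx
    · intro x _
      exact neg_neg x
  have h3 : aeval ω (gaussPoly p) ^ 2 = 1 := by
    have h := aeval_eq_of_aeval_ep_eq hω (P := gaussPoly p ^ 2) (Q := C ((-1) ^ (p / 2) * (p : ℤ)))
      (by
        simp only [map_pow, aeval_ep_gaussPoly, one_mul, sum_eta0_mul_ep_sq hp, aeval_C]
        simp)
    rw [map_pow, aeval_C] at h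
    rw [h]
    simp [hpK, CharTwo.neg_eq]
  have h4 : ω ^ (2 * c.val) = 1 := by
    have he' : (e : K) ^ 2 = 1 := by exact_mod_cast congrArg (Int.cast : ℤ → K) he
    rw [h2] at h1
    have h5 := congrArg (· ^ 2) h1
    simp only [mul_pow, he', ← pow_mul] at h5
    rw [mul_comm m 2, pow_mul, h3, one_pow, one_pow, one_mul, one_mul, mul_comm] at h5
    exact h5.symm
  have h6 := (Nat.Coprime.dvd_mul_left (hodd.coprime_two_right)).mp (hω.dvd_of_pow_eq_one _ h4)
  exact (ZMod.val_eq_zero c).mp (Nat.eq_zero_of_dvd_of_lt h6 (ZMod.val_lt c))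

lemma exists_int_cast_eq_sign {ε : ℂ} (hε : ε = 1 ∨ ε = -1) : ∃ e : ℤ, e ^ 2 = 1 ∧ (e : ℂ) = ε := by
  rcases hε with rfl | rfl
  · exact ⟨1, by norm_num, by simp⟩
  · exact ⟨-1, by norm_num, by simp⟩

section Counting

variable {F : Type*} [Field F] [Fintype F] [Algebra (ZMod p) F]

lemma sum_ep_trace {β : F} (hβ : β ≠ 0) :
    ∑ x : F, ep p (Algebra.trace (ZMod p) F (β * x)) = 0 := by
  let ψ : AddChar F ℂ := (ZMod.stdAddChar (N := p)).compAddMonoidHom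
    ((Algebra.trace (ZMod p) F).toAddMonoidHom.comp (AddMonoidHom.mulLeft β))
  have hψ : ψ ≠ 1 := by
    intro h
    obtain ⟨c, hc⟩ := Algebra.trace_surjective (ZMod p) F 1
    have h1 : ψ (β⁻¹ * c) = ZMod.stdAddChar (1 : ZMod p) := by
      change ZMod.stdAddChar (Algebra.trace (ZMod p) F (β * (β⁻¹ * c))) = _
      rw [mul_inv_cancel_left₀ hβ, hc]
    rw [h, AddChar.one_apply, ← AddChar.map_zero_eq_one (ZMod.stdAddChar (N := p))] at h1
    exact zero_ne_one (ZMod.injective_stdAddChar h1)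
  rw [← AddChar.sum_eq_zero_of_ne_one hψ]
  exact Finset.sum_congr rfl fun x _ => ep_eq_stdAddChar _

omit [Fintype F] in
lemma trace_smul_mul (u : ZMod p) (β x : F) :
    Algebra.trace (ZMod p) F (u • β * x) = u * Algebra.trace (ZMod p) F (β * x) := by
  rw [smul_mul_assoc, map_smul, smul_eq_mul]

lemma sq_mul_card_eq (f : F → ZMod p) {β : F} (hβ : β ≠ 0) :
    (p : ℂ) ^ 2 * ((Finset.univ.filter fun x : F =>
      f x = 0 ∧ Algebra.trace (ZMod p) F (β * x) = 0).card : ℂ) =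
    Fintype.card F + ∑ y ∈ Finset.univ.erase (0 : ZMod p), ∑ u : ZMod p,
      ∑ x, ep p (y * (f x - Algebra.trace (ZMod p) F (u • β * x))) := by
  have h1 : (p : ℂ) ^ 2 * ((Finset.univ.filter fun x : F =>
      f x = 0 ∧ Algebra.trace (ZMod p) F (β * x) = 0).card : ℂ) =
      ∑ x : F, ∑ y : ZMod p, ep p (y * f x) *
        ∑ z : ZMod p, ep p (z * Algebra.trace (ZMod p) F (β * x)) := by
    rw [Finset.card_filter, Nat.cast_sum, Finset.mul_sum]
    refine Finset.sum_congr rfl fun x _ => ?_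
    rw [← Finset.sum_mul, sum_ep_mul, sum_ep_mul]
    by_cases h : f x = 0 <;> by_cases h' : Algebra.trace (ZMod p) F (β * x) = 0 <;>
      simp [h, h', sq]
  rw [h1, Finset.sum_comm, ← Finset.add_sum_erase _ _ (Finset.mem_univ (0 : ZMod p))]
  congr 1
  · simp only [zero_mul, ep_zero, one_mul]
    rw [Finset.sum_comm, Finset.sum_eq_single (0 : ZMod p)]
    · simp [ep_zero]
    · intro z _ hz
      simp only [← trace_smul_mul]
      exact sum_ep_trace (smul_ne_zero hz hβ)
    · simp
  · refine Finset.sum_congr rfl fun y hy => ?_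
    have hy0 : -y ≠ 0 := neg_ne_zero.mpr (Finset.ne_of_mem_erase hy)
    rw [Finset.sum_comm (s := Finset.univ (α := ZMod p))]
    refine Finset.sum_congr rfl fun x _ => ?_
    rw [Finset.mul_sum, ← Equiv.sum_comp (Equiv.mulLeft₀ (-y) hy0)]
    refine Finset.sum_congr rfl fun u _ => ?_
    rw [← ep_add, trace_smul_mul]
    change ep p (y * f x + -y * u * _) = _
    congr 1
    ring

lemma walsh_smul_unit {f : F → ZMod p} {h : ℕ}
    (hf : ∀ (a : (ZMod p)ˣ) (x : F),
      f (algebraMap (ZMod p) F (a : ZMod p) * x) = (a : ZMod p) ^ h * f x)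
    (a : (ZMod p)ˣ) (β : F) :
    walsh p f β = ∑ x, ep p ((a : ZMod p) ^ h *
      (f x - Algebra.trace (ZMod p) F (((a * (a ^ h)⁻¹ : (ZMod p)ˣ) : ZMod p) • β * x))) := by
  have ha : algebraMap (ZMod p) F (a : ZMod p) ≠ 0 := by simp
  rw [walsh, ← Equiv.sum_comp (Equiv.mulLeft₀ _ ha)]
  refine Finset.sum_congr rfl fun x _ => ?_
  change ep p (f (algebraMap (ZMod p) F a * x) -
    Algebra.trace (ZMod p) F (β * (algebraMap (ZMod p) F a * x))) = _
  rw [hf, ← Algebra.smul_def, mul_smul_comm, map_smul, smul_eq_mul, trace_smul_mul, mul_sub]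
  congr 2
  have h1 : (a : ZMod p) ^ h * ((a * (a ^ h)⁻¹ : (ZMod p)ˣ) : ZMod p) = a := by
    rw [← Units.val_pow_eq_pow_val, ← Units.val_mul, mul_comm a, mul_inv_cancel_left]
  rw [← mul_assoc, h1]

lemma ep_injective : Function.Injective (ep p) := by
  intro a b h
  rw [ep_eq_stdAddChar, ep_eq_stdAddChar] at h
  exact ZMod.injective_stdAddChar h

lemma IsWRP.twist {n s : ℕ} (hp : p ≠ 2) {f g : F → ZMod p} {ε : ℂ} (hf : IsWRP p n s f ε g)
    {β : F} (hβ : walsh p f β ≠ 0) {y : ZMod p} (hy : y ≠ 0) :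
    ∑ x, ep p (y * (f x - Algebra.trace (ZMod p) F (β * x))) =
      ε * (eta0 p y * sqrtPStar p) ^ (n + s) * ep p (y * g β) := by
  obtain ⟨e, -, rfl⟩ := exists_int_cast_eq_sign hf.1.1
  exact sum_ep_twist_of_eq hp (hf.1.2.1 β hβ) hy

/-- The Walsh support is stable under scaling, along which the dual changes by square factors. -/
lemma IsWRP.scaling {n s : ℕ} (hp : p ≠ 2) {f g : F → ZMod p} {ε : ℂ} (hf : IsWRP p n s f ε g)
    {u : ZMod p} (hu : u ≠ 0) (β : F) :
    (walsh p f β = 0 → walsh p f (u • β) = 0) ∧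
    (walsh p f β ≠ 0 → walsh p f (u • β) ≠ 0 ∧ ∃ c ≠ 0, g (u • β) = c ^ 2 * g β) := by
  have key : ∀ {u : ZMod p}, u ≠ 0 → ∀ β : F, walsh p f β ≠ 0 → walsh p f (u • β) ≠ 0 ∧
      ∃ c ≠ 0, g (u • β) = c ^ 2 * g β := by
    intro u hu β hβ
    have hf' := hf
    obtain ⟨-, -, -, h, hh0, ⟨k, hk⟩, hcop, hhom⟩ := hf'
    have hcop' : (Nat.card (ZMod p)ˣ).Coprime (h - 1) := by
      rw [Nat.card_eq_fintype_card, ZMod.card_units]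
      exact Nat.Coprime.symm hcop
    obtain ⟨a, ha⟩ := (powCoprime hcop').surjective (Units.mk0 u hu)⁻¹
    rw [powCoprime_apply] at ha
    have hu' : (a * (a ^ h)⁻¹ : (ZMod p)ˣ) = Units.mk0 u hu := by
      rw [← inv_inj, ← ha, mul_inv_rev, inv_inv, mul_inv_eq_iff_eq_mul, ← pow_succ,
        Nat.sub_add_cancel hh0]
    have hw := walsh_smul_unit hhom a β
    rw [hu', Units.val_mk0] at hw
    have hah : (a : ZMod p) ^ h ≠ 0 := pow_ne_zero _ a.ne_zero
    have hne : walsh p f (u • β) ≠ 0 := by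
      intro h0
      exact hβ (hw.trans (sum_ep_twist_of_eq_zero h0 hah))
    refine ⟨hne, ((a : ZMod p) ^ k)⁻¹, inv_ne_zero (pow_ne_zero _ a.ne_zero), ?_⟩
    rw [hf.twist hp hne hah, hf.1.2.1 β hβ] at hw
    have hη : eta0 p ((a : ZMod p) ^ h) = 1 := by
      rw [hk, pow_add, eta0_mul, ← sq, eta0_sq (pow_ne_zero _ a.ne_zero)]
    rw [hη, one_mul] at hw
    have hε : ε ≠ 0 := by rcases hf.1.1 with rfl | rfl <;> norm_num
    have hg := ep_injective
      (mul_left_cancel₀ (mul_ne_zero hε (pow_ne_zero _ sqrtPStar_ne_zero)) hw)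
    rw [hg, hk, pow_add]
    have := pow_ne_zero k a.ne_zero
    field_simp
  refine ⟨fun h0 => ?_, key hu β⟩
  by_contra hne
  have h1 := (key (inv_ne_zero hu) _ hne).1
  rw [inv_smul_smul₀ hu] at h1
  exact h1 h0

lemma IsWRP.dual_zero {n s : ℕ} (hp : p ≠ 2) {f g : F → ZMod p} {ε : ℂ} (hf : IsWRP p n s f ε g) :
    g 0 = 0 := by
  obtain ⟨e, he, rfl⟩ := exists_int_cast_eq_sign hf.1.1
  have hf' := hf
  obtain ⟨-, h0, hf0, h, -, heven, -, hhom⟩ := hf'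
  have : NeZero (p : AlgebraicClosure (ZMod 2)) := by
    refine ⟨fun h => ?_⟩
    rw [← map_natCast (algebraMap (ZMod 2) _), map_eq_zero, ZMod.natCast_eq_zero_iff] at h
    exact hp ((Nat.prime_dvd_prime_iff_eq Nat.prime_two Fact.out).mp h).symm
  have : CharP (AlgebraicClosure (ZMod 2)) 2 :=
    charP_of_injective_algebraMap (algebraMap (ZMod 2) _).injective 2
  obtain ⟨ω, hω⟩ := IsAlgClosed.exists_root (cyclotomic p (AlgebraicClosure (ZMod 2)))
    (degree_cyclotomic_pos p _ (Fact.out : p.Prime).pos).ne'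
  refine eq_zero_of_sum_ep_eq hp (isRoot_cyclotomic_iff.mp hω) hf0 (fun x => ?_) he
    (m := n + s) (c := g 0) ?_
  · have := hhom (-1) x
    simpa [heven.neg_one_pow] using this
  · rw [← hf.1.2.1 0 h0]
    simp [walsh]

lemma sum_eta0_pow_mul_ep_of_even {m : ℕ} (hm : Even m) (c : ZMod p) :
    ∑ y ∈ Finset.univ.erase 0, eta0 p y ^ m * ep p (y * c) = (if c = 0 then (p : ℂ) else 0) - 1 := by
  obtain ⟨k, rfl⟩ := hm
  rw [← sum_ep_mul c, Finset.sum_congr rfl (g := fun y => ep p (y * c)), sum_ne_zero_eq,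
    zero_mul, ep_zero]
  intro y hy
  rw [← two_mul, pow_mul, eta0_sq (Finset.ne_of_mem_erase hy), one_pow, one_mul]

lemma sum_eta0_pow_mul_ep_of_odd (hp : p ≠ 2) {m : ℕ} (hm : Odd m) (c : ZMod p) :
    ∑ y ∈ Finset.univ.erase 0, eta0 p y ^ m * ep p (y * c) = eta0 p c * sqrtPStar p := by
  obtain ⟨k, rfl⟩ := hm
  have h0 : eta0 p 0 = 0 := by simp [eta0]
  rw [Finset.sum_congr rfl (g := fun y => eta0 p y * ep p (c * y)), sum_ne_zero_eq,
    h0, zero_mul, sub_zero]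
  · by_cases hc : c = 0
    · simp [hc, ep_zero, h0, sum_eta0 hp]
    · rw [sum_eta0_mul_ep c hc, sum_eta0_mul_ep_eq_sqrtPStar hp]
  · intro y hy
    rw [pow_succ, pow_mul, eta0_sq (Finset.ne_of_mem_erase hy), one_pow, one_mul, mul_comm y c]

/-- The character sum `∑_{y ≠ 0} η₀(y)^m ξ_p^{yc}` is unchanged when `c` is multiplied by a nonzero
square. -/
lemma sum_eta0_pow_mul_ep_sq_mul (hp : p ≠ 2) (m : ℕ) {c : ZMod p} (hc : c ≠ 0) (a : ZMod p) :
    ∑ y ∈ Finset.univ.erase 0, eta0 p y ^ m * ep p (y * (c ^ 2 * a)) =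
      ∑ y ∈ Finset.univ.erase 0, eta0 p y ^ m * ep p (y * a) := by
  rcases Nat.even_or_odd m with hm | hm
  · rw [sum_eta0_pow_mul_ep_of_even hm, sum_eta0_pow_mul_ep_of_even hm]
    simp [hc]
  · rw [sum_eta0_pow_mul_ep_of_odd hp hm, sum_eta0_pow_mul_ep_of_odd hp hm, eta0_mul, sq c,
      eta0_mul, ← sq (eta0 p c), eta0_sq hc, one_mul]

lemma IsWRP.sum_twist {n s : ℕ} (hp : p ≠ 2) {f g : F → ZMod p} {ε : ℂ} (hf : IsWRP p n s f ε g)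
    {β : F} (hβ : walsh p f β ≠ 0) :
    ∑ y ∈ Finset.univ.erase (0 : ZMod p),
        ∑ x, ep p (y * (f x - Algebra.trace (ZMod p) F (β * x))) =
      ε * sqrtPStar p ^ (n + s) *
        ∑ y ∈ Finset.univ.erase 0, eta0 p y ^ (n + s) * ep p (y * g β) := by
  rw [Finset.mul_sum]
  refine Finset.sum_congr rfl fun y hy => ?_
  rw [hf.twist hp hβ (Finset.ne_of_mem_erase hy), mul_pow]
  ring

lemma IsWRP.sq_mul_card_of_walsh_eq_zero {n s : ℕ} (hp : p ≠ 2) {f g : F → ZMod p} {ε : ℂ}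
    (hf : IsWRP p n s f ε g) {β : F} (hβ0 : β ≠ 0) (hβ : walsh p f β = 0) :
    (p : ℂ) ^ 2 * ((Finset.univ.filter fun x : F =>
      f x = 0 ∧ Algebra.trace (ZMod p) F (β * x) = 0).card : ℂ) =
    Fintype.card F + ε * sqrtPStar p ^ (n + s) *
      ∑ y ∈ Finset.univ.erase 0, eta0 p y ^ (n + s) * ep p (y * 0) := by
  have h0 := hf.sum_twist hp hf.2.1
  rw [hf.dual_zero hp] at h0
  rw [sq_mul_card_eq f hβ0, ← h0]
  congr 1
  refine Finset.sum_congr rfl fun y hy => ?_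
  rw [Finset.sum_eq_single 0, zero_smul]
  · intro u _ hu
    exact sum_ep_twist_of_eq_zero ((hf.scaling hp hu β).1 hβ) (Finset.ne_of_mem_erase hy)
  · simp

lemma IsWRP.sq_mul_card_of_walsh_ne_zero {n s : ℕ} (hp : p ≠ 2) {f g : F → ZMod p} {ε : ℂ}
    (hf : IsWRP p n s f ε g) {β : F} (hβ0 : β ≠ 0) (hβ : walsh p f β ≠ 0) :
    (p : ℂ) ^ 2 * ((Finset.univ.filter fun x : F =>
      f x = 0 ∧ Algebra.trace (ZMod p) F (β * x) = 0).card : ℂ) =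
    Fintype.card F + ε * sqrtPStar p ^ (n + s) *
      (∑ y ∈ Finset.univ.erase 0, eta0 p y ^ (n + s) * ep p (y * 0) +
        (p - 1) * ∑ y ∈ Finset.univ.erase 0, eta0 p y ^ (n + s) * ep p (y * g β)) := by
  rw [sq_mul_card_eq f hβ0, Finset.sum_comm,
    ← Finset.add_sum_erase _ _ (Finset.mem_univ (0 : ZMod p)), zero_smul, hf.sum_twist hp hf.2.1,
    hf.dual_zero hp, mul_add]
  congr 2
  have h1 : ∀ u ∈ Finset.univ.erase (0 : ZMod p), ∑ y ∈ Finset.univ.erase (0 : ZMod p),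
      ∑ x, ep p (y * (f x - Algebra.trace (ZMod p) F (u • β * x))) =
      ε * sqrtPStar p ^ (n + s) *
        ∑ y ∈ Finset.univ.erase 0, eta0 p y ^ (n + s) * ep p (y * g β) := by
    intro u hu
    obtain ⟨hne, c, hc, hg⟩ := (hf.scaling hp (Finset.ne_of_mem_erase hu) β).2 hβ
    rw [hf.sum_twist hp hne, hg, sum_eta0_pow_mul_ep_sq_mul hp _ hc]
  rw [Finset.sum_congr rfl h1, Finset.sum_const, Finset.card_erase_of_mem (Finset.mem_univ _),
    Finset.card_univ, ZMod.card, nsmul_eq_mul, Nat.cast_sub (Fact.out : p.Prime).one_le,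
    Nat.cast_one]
  ring

end Counting

end Basic
theorem statement_8 (p n s : ℕ) [Fact p.Prime] (hp : p ≠ 2) (hn : 0 < n) (hs : s ≤ n)
    {F : Type*} [Field F] [Fintype F] [Algebra (ZMod p) F]
    (hq : Fintype.card F = p ^ n)
    (f g : F → ZMod p) (ε : ℂ)
    (hf : IsWRP p n s f ε g) :
    ∀ β : F, β ≠ 0 →
      (walsh p f β = 0 →
        (Even (n + s) →
          ((Finset.univ.filter fun x : F => f x = 0 ∧ Algebra.trace (ZMod p) F (β * x) = 0).card : ℂ)
            = (p : ℂ) ^ ((n : ℤ) - 2)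
              + ε * ((p : ℂ) - 1) * sqrtPStar p ^ ((n : ℤ) + s - 4)) ∧
        (Odd (n + s) →
          ((Finset.univ.filter fun x : F => f x = 0 ∧ Algebra.trace (ZMod p) F (β * x) = 0).card : ℂ) = (p : ℂ) ^ ((n : ℤ) - 2))) ∧
      (walsh p f β ≠ 0 →
        (Even (n + s) →
          (g β = 0 →
            ((Finset.univ.filter fun x : F => f x = 0 ∧ Algebra.trace (ZMod p) F (β * x) = 0).card : ℂ)
              = (p : ℂ) ^ ((n : ℤ) - 2)
                + ε * eta0 p (-1) * ((p : ℂ) - 1) * sqrtPStar p ^ ((n : ℤ) + s - 2)) ∧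
          (g β ≠ 0 →
            ((Finset.univ.filter fun x : F => f x = 0 ∧ Algebra.trace (ZMod p) F (β * x) = 0).card : ℂ) = (p : ℂ) ^ ((n : ℤ) - 2))) ∧
        (Odd (n + s) →
          (g β = 0 →
            ((Finset.univ.filter fun x : F => f x = 0 ∧ Algebra.trace (ZMod p) F (β * x) = 0).card : ℂ) = (p : ℂ) ^ ((n : ℤ) - 2)) ∧
          (g β ≠ 0 → IsSquare (g β) →
            ((Finset.univ.filter fun x : F => f x = 0 ∧ Algebra.trace (ZMod p) F (β * x) = 0).card : ℂ)
              = (p : ℂ) ^ ((n : ℤ) - 2)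
                + ε * ((p : ℂ) - 1) * sqrtPStar p ^ ((n : ℤ) + s - 3)) ∧
          (g β ≠ 0 → ¬ IsSquare (g β) →
            ((Finset.univ.filter fun x : F => f x = 0 ∧ Algebra.trace (ZMod p) F (β * x) = 0).card : ℂ)
              = (p : ℂ) ^ ((n : ℤ) - 2)
                - ε * ((p : ℂ) - 1) * sqrtPStar p ^ ((n : ℤ) + s - 3)))) := by
  intro β hβ0
  have hp0 : (p : ℂ) ≠ 0 := by exact_mod_cast (Fact.out : p.Prime).ne_zero
  have hP := sqrtPStar_ne_zero (p := p)
  have hP2 : sqrtPStar p ^ 2 = eta0 p (-1) * p := by rw [sqrtPStar_sq hp, eta0_neg_one hp]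
  have hη : eta0 p (-1) ^ 2 = 1 := eta0_sq (neg_ne_zero.mpr one_ne_zero)
  have hcard : (Fintype.card F : ℂ) = p ^ n := by rw [hq, Nat.cast_pow]
  have hzp : (p : ℂ) ^ ((n : ℤ) - 2) = p ^ n / p ^ 2 := by
    rw [zpow_sub₀ hp0]; norm_cast
  have hzP : ∀ k : ℕ, sqrtPStar p ^ ((n : ℤ) + s - k) = sqrtPStar p ^ (n + s) / sqrtPStar p ^ k := by
    intro k
    rw [zpow_sub₀ hP]; norm_cast
  have hη0 : eta0 p 0 = 0 := by simp [eta0]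
  have hP4 : sqrtPStar p ^ 4 = p ^ 2 := by
    linear_combination (sqrtPStar p ^ 2 + eta0 p (-1) * p) * hP2 + (p : ℂ) ^ 2 * hη
  refine ⟨fun hβ => ?_, fun hβ => ?_⟩
  · have key := hf.sq_mul_card_of_walsh_eq_zero hp hβ0 hβ
    rw [hcard] at key
    refine ⟨fun hm => ?_, fun hm => ?_⟩
    · rw [sum_eta0_pow_mul_ep_of_even hm, if_pos rfl] at key
      have h4 := hzP 4
      rw [Nat.cast_ofNat, hP4] at h4
      rw [h4, hzp]
      field_simp
      linear_combination key
    · rw [sum_eta0_pow_mul_ep_of_odd hp hm, hη0] at key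
      rw [hzp]
      field_simp
      linear_combination key
  · have key := hf.sq_mul_card_of_walsh_ne_zero hp hβ0 hβ
    rw [hcard] at key
    refine ⟨fun hm => ?_, fun hm => ?_⟩
    · rw [sum_eta0_pow_mul_ep_of_even hm, sum_eta0_pow_mul_ep_of_even hm, if_pos rfl] at key
      refine ⟨fun hg => ?_, fun hg => ?_⟩
      · rw [if_pos hg] at key
        have h2 := hzP 2
        have hinv : eta0 p (-1) / sqrtPStar p ^ 2 = 1 / p := by
          rw [div_eq_div_iff (pow_ne_zero 2 hP) hp0, hP2]; ring
        rw [Nat.cast_ofNat] at h2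
        have h3 : ε * eta0 p (-1) * ((p : ℂ) - 1) * (sqrtPStar p ^ (n + s) / sqrtPStar p ^ 2) =
            ε * ((p : ℂ) - 1) * sqrtPStar p ^ (n + s) * (1 / p) := by
          rw [← hinv]; ring
        rw [h2, h3, hzp]
        field_simp
        linear_combination key
      · rw [if_neg hg] at key
        rw [hzp]
        field_simp
        linear_combination key
    · rw [sum_eta0_pow_mul_ep_of_odd hp hm, sum_eta0_pow_mul_ep_of_odd hp hm, hη0] at key
      have h3 : sqrtPStar p ^ ((n : ℤ) + s - 3) = sqrtPStar p ^ (n + s) * sqrtPStar p / p ^ 2 := by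
        have h := hzP 3
        rw [Nat.cast_ofNat] at h
        rw [h, ← hP4]
        field_simp
      refine ⟨fun hg => ?_, fun hg hsq => ?_, fun hg hsq => ?_⟩
      · rw [hg, hη0] at key
        rw [hzp]
        field_simp
        linear_combination key
      · have he : eta0 p (g β) = 1 := by
          rw [eta0, (quadraticChar_one_iff_isSquare hg).mpr hsq, Int.cast_one]
        rw [he] at key
        rw [h3, hzp]
        field_simp
        linear_combination key
      · have he : eta0 p (g β) = -1 := by
          rw [eta0, quadraticChar_neg_one_iff_not_isSquare.mpr hsq, Int.cast_neg, Int.cast_one]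
        rw [he] at key
        rw [h3, hzp]
        field_simp
        linear_combination key
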